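/- arXiv:2407.06361 — 2 statements merged into one kernel-verified Lean document; each statement's English description precedes it below -/
import Mathlib

section
/- For every choice of pairwise distinct points x, y, z of the circle S¹, the intersection ξ²(x) ∩ ξ²(y) ∩ ξ²(z) of the three tangent planes is the zero subspace of ℝ³. In particular, for x ≠ y the subspace ξ²(x) ∩ ξ²(y) is 1-dimensional. -/
noncomputable section

open Filter Topology Module
open scoped LinearAlgebra.Projectivization

namespace CFF

instance {K V : Type*} [DivisionRing K] [AddCommGroup V] [Module K V] [TopologicalSpace V] :
    TopologicalSpace (ℙ K V) :=
  inferInstanceAs (TopologicalSpace (Quotient (projectivizationSetoid K V)))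

instance : TopologicalSpace (Module.Dual ℝ (Fin 3 → ℝ)) :=
  TopologicalSpace.induced (LinearEquiv.piRing ℝ ℝ (Fin 3) ℝ) inferInstance

/-- The projective line in `ℙ(ℝ³)` determined by a plane `W ≤ ℝ³`. -/
def projLine (W : Submodule ℝ (Fin 3 → ℝ)) : Set (ℙ ℝ (Fin 3 → ℝ)) :=
  {p | p.submodule ≤ W}

/-- `C ⊆ ℙ(ℝ³)` is properly convex: there is a linear functional `f` nonzero on every nonzero
vector spanning a point of the closure of `C`, such that the image of `C` in the affine chart
`{[v] : f v = 1}` is convex. -/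
def ProperlyConvex (C : Set (ℙ ℝ (Fin 3 → ℝ))) : Prop :=
  ∃ f : (Fin 3 → ℝ) →ₗ[ℝ] ℝ,
    (∀ (v : Fin 3 → ℝ) (hv : v ≠ 0), Projectivization.mk ℝ v hv ∈ closure C → f v ≠ 0) ∧
    Convex ℝ {w : Fin 3 → ℝ | f w = 1 ∧ ∃ hw : w ≠ 0, Projectivization.mk ℝ w hw ∈ C}

/-- The frontier of `C` contains no three distinct collinear points. -/
def StrictlyConvexBoundary (C : Set (ℙ ℝ (Fin 3 → ℝ))) : Prop :=
  ∀ p q r : ℙ ℝ (Fin 3 → ℝ), p ∈ frontier C → q ∈ frontier C → r ∈ frontier C →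
    p ≠ q → p ≠ r → q ≠ r →
    ∀ W : Submodule ℝ (Fin 3 → ℝ), finrank ℝ W = 2 →
      ¬ (p.submodule ≤ W ∧ q.submodule ≤ W ∧ r.submodule ≤ W)

/-- `W` determines a supporting line of `C` at the frontier point `p`: a projective line
containing `p` and disjoint from `C`. -/
def IsSupportingLineAt (C : Set (ℙ ℝ (Fin 3 → ℝ))) (W : Submodule ℝ (Fin 3 → ℝ))
    (p : ℙ ℝ (Fin 3 → ℝ)) : Prop :=
  finrank ℝ W = 2 ∧ p ∈ frontier C ∧ p.submodule ≤ W ∧ projLine W ∩ C = ∅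

/-- `(x, y, z)` is a positively oriented triple on the circle: `y` and `z` occur in that order
when traversing the circle counterclockwise starting from `x`.  (This implies the three points
are pairwise distinct.) -/
def PosOriented (x y z : Circle) : Prop :=
  ∃ a b c : ℝ, Circle.exp a = x ∧ Circle.exp b = y ∧ Circle.exp c = z ∧
    a < b ∧ b < c ∧ c < a + 2 * Real.pi

/-- The space of flags `(p, l)`, realized inside `ℙ(ℝ³) × ℙ((ℝ³)*)`: the pair `(p, φ)`
represents the flag whose line is the plane annihilated by `φ`, and `p` must lie on it. -/
def Flags : Set (ℙ ℝ (Fin 3 → ℝ) × ℙ ℝ (Module.Dual ℝ (Fin 3 → ℝ))) :=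
  {pl | pl.1.submodule ≤ pl.2.submodule.dualCoannihilator}

/-- The flags `(p, l)` with `p` outside the closure of `C` and `ℙ(l)` meeting `C`. -/
def Omega2 (C : Set (ℙ ℝ (Fin 3 → ℝ))) :
    Set (ℙ ℝ (Fin 3 → ℝ) × ℙ ℝ (Module.Dual ℝ (Fin 3 → ℝ))) :=
  {pl | pl ∈ Flags ∧ pl.1 ∉ closure C ∧
    ∃ q ∈ C, q.submodule ≤ pl.2.submodule.dualCoannihilator}


lemma mk_smul_self (f : (Fin 3 → ℝ) →ₗ[ℝ] ℝ) (v : Fin 3 → ℝ) (hv : v ≠ 0) (h : f v ≠ 0)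
    (h' : (f v)⁻¹ • v ≠ 0) :
    Projectivization.mk ℝ ((f v)⁻¹ • v) h' = Projectivization.mk ℝ v hv := by
  rw [Projectivization.mk_eq_mk_iff']
  exact ⟨(f v)⁻¹, rfl⟩

lemma isOpen_pre (O : Set (ℙ ℝ (Fin 3 → ℝ))) (hO : IsOpen O) :
    IsOpen {v : Fin 3 → ℝ | ∃ hv : v ≠ 0, Projectivization.mk ℝ v hv ∈ O} := by
  have hc : Continuous (fun v : {v : Fin 3 → ℝ // v ≠ 0} => Projectivization.mk ℝ v.1 v.2) :=
    continuous_quotient_mk'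
  have h1 := hO.preimage hc
  have h2 : IsOpen {v : Fin 3 → ℝ | v ≠ 0} := isOpen_ne
  have h3 := h2.isOpenMap_subtype_val _ h1
  convert h3 using 1
  ext v
  simp

lemma isOpen_of_pre (O : Set (ℙ ℝ (Fin 3 → ℝ)))
    (h : IsOpen {v : Fin 3 → ℝ | ∃ hv : v ≠ 0, Projectivization.mk ℝ v hv ∈ O}) : IsOpen O := by
  have hq : IsQuotientMap (fun v : {v : Fin 3 → ℝ // v ≠ 0} => Projectivization.mk ℝ v.1 v.2) :=
    isQuotientMap_quotient_mk'
  rw [← hq.isOpen_preimage]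
  have := h.preimage (continuous_subtype_val (p := fun v : Fin 3 → ℝ => v ≠ 0))
  convert this using 1
  ext v
  simp [v.2]

def chartSet (f : (Fin 3 → ℝ) →ₗ[ℝ] ℝ) (C : Set (ℙ ℝ (Fin 3 → ℝ))) : Set (Fin 3 → ℝ) :=
  {w : Fin 3 → ℝ | f w = 1 ∧ ∃ hw : w ≠ 0, Projectivization.mk ℝ w hw ∈ C}

lemma mem_closure_chart (f : (Fin 3 → ℝ) →ₗ[ℝ] ℝ) (C : Set (ℙ ℝ (Fin 3 → ℝ)))
    (w : Fin 3 → ℝ) (hw : w ≠ 0) (hf : f w = 1)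
    (h : Projectivization.mk ℝ w hw ∈ closure C) : w ∈ closure (chartSet f C) := by
  rw [mem_closure_iff] at h ⊢
  intro U hU hwU
  have hfc : Continuous f := f.continuous_of_finiteDimensional
  let T : Set (ℙ ℝ (Fin 3 → ℝ)) :=
    {p | ∃ (v : Fin 3 → ℝ) (hv : v ≠ 0), p = Projectivization.mk ℝ v hv ∧ f v = 1 ∧ v ∈ U}
  have hT : IsOpen T := by
    apply isOpen_of_pre
    have : {v : Fin 3 → ℝ | ∃ hv : v ≠ 0, Projectivization.mk ℝ v hv ∈ T}
        = {v | f v ≠ 0} ∩ (fun v => (f v)⁻¹ • v) ⁻¹' U := by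
      ext v
      constructor
      · rintro ⟨hv, u, hu, he, hfu, huU⟩
        obtain ⟨a, ha⟩ := (Projectivization.mk_eq_mk_iff' ℝ _ _ hv hu).1 he
        have h1 : f v = a := by rw [← ha]; simp [hfu]
        have ha0 : a ≠ 0 := by
          rintro rfl
          exact hv (by rw [← ha]; simp)
        refine ⟨by simpa [h1] using ha0, ?_⟩
        have : (f v)⁻¹ • v = u := by rw [h1, ← ha, smul_smul, inv_mul_cancel₀ ha0, one_smul]
        simpa [this] using huU
      · rintro ⟨h1, h2⟩
        have h1 : f v ≠ 0 := h1
        have hv : v ≠ 0 := by rintro rfl; simp at h1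
        have hv' : (f v)⁻¹ • v ≠ 0 := smul_ne_zero (inv_ne_zero h1) hv
        exact ⟨hv, _, hv', (mk_smul_self f v hv h1 hv').symm, by simp [h1], h2⟩
    rw [this]
    have hop : IsOpen {v | f v ≠ 0} := isOpen_ne_fun hfc continuous_const
    refine ContinuousOn.isOpen_inter_preimage ?_ hop hU
    exact (ContinuousOn.inv₀ hfc.continuousOn (fun v hv => hv)).smul continuousOn_id
  obtain ⟨p, ⟨v, hv, rfl, hfv, hvU⟩, hpC⟩ := h T hT ⟨w, hw, rfl, hf, hwU⟩
  exact ⟨v, hvU, hfv, hv, hpC⟩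

lemma mem_closure_of_chart (f : (Fin 3 → ℝ) →ₗ[ℝ] ℝ) (C : Set (ℙ ℝ (Fin 3 → ℝ)))
    (w : Fin 3 → ℝ) (hw : w ≠ 0) (h : w ∈ closure (chartSet f C)) :
    Projectivization.mk ℝ w hw ∈ closure C := by
  rw [mem_closure_iff] at h ⊢
  intro O hO hwO
  obtain ⟨v, ⟨hv, hvO⟩, _, hv', hvC⟩ := h _ (isOpen_pre O hO) ⟨hw, hwO⟩
  exact ⟨_, hvO, hvC⟩

lemma mk_mem_line (W : Submodule ℝ (Fin 3 → ℝ)) (w : Fin 3 → ℝ) (hw : w ≠ 0) :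
    (Projectivization.mk ℝ w hw).submodule ≤ W ↔ w ∈ W := by
  rw [Projectivization.submodule_mk, Submodule.span_singleton_le_iff_mem]

lemma no_two (f : (Fin 3 → ℝ) →ₗ[ℝ] ℝ) (C : Set (ℙ ℝ (Fin 3 → ℝ))) (hC : IsOpen C)
    (hconv : Convex ℝ (chartSet f C)) (hstrict : StrictlyConvexBoundary C)
    (W : Submodule ℝ (Fin 3 → ℝ)) (hW : finrank ℝ W = 2) (hd : projLine W ∩ C = ∅)
    (p q : Fin 3 → ℝ) (hp0 : p ≠ 0) (hq0 : q ≠ 0) (hp : f p = 1) (hq : f q = 1)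
    (hpF : Projectivization.mk ℝ p hp0 ∈ frontier C)
    (hqF : Projectivization.mk ℝ q hq0 ∈ frontier C)
    (hpq : p ≠ q) (hpW : p ∈ W) (hqW : q ∈ W) : False := by
  have inj : ∀ (a b : Fin 3 → ℝ) (ha : a ≠ 0) (hb : b ≠ 0), f a = 1 → f b = 1 → a ≠ b →
      Projectivization.mk ℝ a ha ≠ Projectivization.mk ℝ b hb := by
    intro a b ha hb h1 h2 hab he
    obtain ⟨c, hc⟩ := (Projectivization.mk_eq_mk_iff' ℝ _ _ ha hb).1 he
    have : c = 1 := by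
      have := congrArg f hc
      simpa [h1, h2] using this
    subst this
    exact hab (by simpa using hc.symm)
  have hpc := mem_closure_chart f C p hp0 hp (frontier_subset_closure hpF)
  have hqc := mem_closure_chart f C q hq0 hq (frontier_subset_closure hqF)
  let m : Fin 3 → ℝ := (1/2 : ℝ) • p + (1/2 : ℝ) • q
  have hm : m ∈ closure (chartSet f C) :=
    hconv.closure hpc hqc (by norm_num) (by norm_num) (by norm_num)
  have hfm : f m = 1 := by simp only [m, map_add, map_smul, hp, hq, smul_eq_mul]; norm_num
  have hm0 : m ≠ 0 := by intro h; rw [h] at hfm; simp at hfm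
  have hmW : m ∈ W := W.add_mem (W.smul_mem _ hpW) (W.smul_mem _ hqW)
  have hmF : Projectivization.mk ℝ m hm0 ∈ frontier C := by
    rw [hC.frontier_eq]
    refine ⟨mem_closure_of_chart f C m hm0 hm, fun h => ?_⟩
    have : Projectivization.mk ℝ m hm0 ∈ projLine W ∩ C := ⟨(mk_mem_line W m hm0).2 hmW, h⟩
    rw [hd] at this
    exact this
  have hpm : p ≠ m := by
    intro h
    apply hpq
    ext i
    have := congrFun h i
    simp only [m, Pi.add_apply, Pi.smul_apply, smul_eq_mul] at this
    linarith
  have hqm : q ≠ m := by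
    intro h
    apply hpq
    ext i
    have := congrFun h i
    simp only [m, Pi.add_apply, Pi.smul_apply, smul_eq_mul] at this
    linarith
  exact hstrict _ _ _ hpF hqF hmF (inj _ _ _ _ hp hq hpq) (inj _ _ _ _ hp hfm hpm)
    (inj _ _ _ _ hq hfm hqm) W hW
    ⟨(mk_mem_line W _ _).2 hpW, (mk_mem_line W _ _).2 hqW, (mk_mem_line W _ _).2 hmW⟩

lemma exists_functional (f : (Fin 3 → ℝ) →ₗ[ℝ] ℝ) (C : Set (ℙ ℝ (Fin 3 → ℝ)))
    (hconv : Convex ℝ (chartSet f C))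
    (W : Submodule ℝ (Fin 3 → ℝ)) (hW : finrank ℝ W = 2) (hd : projLine W ∩ C = ∅) :
    ∃ φ : (Fin 3 → ℝ) →ₗ[ℝ] ℝ, LinearMap.ker φ = W ∧
      ∀ w ∈ closure (chartSet f C), 0 ≤ φ w := by
  have hlt : W < ⊤ := by
    rw [lt_top_iff_ne_top]
    rintro rfl
    simp at hW
  obtain ⟨φ, hφ0, hle⟩ := Submodule.exists_le_ker_of_lt_top W hlt
  have hker : LinearMap.ker φ = W := by
    symm
    apply Submodule.eq_of_le_of_finrank_le hle
    have h1 := LinearMap.finrank_range_add_finrank_ker φ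
    have h2 : LinearMap.range φ = ⊤ := LinearMap.range_eq_top.2 (LinearMap.surjective hφ0)
    rw [h2] at h1
    simp at h1
    omega
  have hne : ∀ w ∈ chartSet f C, φ w ≠ 0 := by
    rintro w ⟨_, hw0, hwC⟩ h
    have hwW : w ∈ W := by rw [← hker]; exact h
    have : Projectivization.mk ℝ w hw0 ∈ projLine W ∩ C := ⟨(mk_mem_line W w hw0).2 hwW, hwC⟩
    rw [hd] at this
    exact this
  have hφc : Continuous φ := φ.continuous_of_finiteDimensional
  by_cases hpos : ∀ w ∈ chartSet f C, 0 ≤ φ w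
  · refine ⟨φ, hker, fun w hw => ?_⟩
    exact closure_minimal hpos (isClosed_le continuous_const hφc) hw
  · push Not at hpos
    obtain ⟨u, hu, hun⟩ := hpos
    have hneg : ∀ w ∈ chartSet f C, φ w ≤ 0 := by
      intro w hw
      by_contra! hwp
      have hD : 0 < φ w - φ u := by linarith
      have hmem := hconv hu hw (a := φ w / (φ w - φ u)) (b := -φ u / (φ w - φ u))
        (by positivity) (div_nonneg (by linarith) hD.le) (by field_simp; ring)
      apply hne _ hmem
      simp only [map_add, map_smul, smul_eq_mul]
      field_simp
      ring
    refine ⟨-φ, ?_, fun w hw => ?_⟩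
    · rw [← hker]; ext w; simp
    · have : φ w ≤ 0 := closure_minimal hneg (isClosed_le hφc continuous_const) hw
      simpa using this

/-- For pairwise distinct points `x, y, z` of the circle, the intersection
`ξ²(x) ⊓ ξ²(y) ⊓ ξ²(z)` of the three tangent planes is the zero subspace of `ℝ³`; and for
`x ≠ y` the subspace `ξ²(x) ⊓ ξ²(y)` is 1-dimensional. -/
theorem statement_0
    (C : Set (ℙ ℝ (Fin 3 → ℝ))) (hCopen : IsOpen C) (hCpc : ProperlyConvex C)
    (hstrict : StrictlyConvexBoundary C)
    (hC1 : ∀ p ∈ frontier C, ∃! W : Submodule ℝ (Fin 3 → ℝ), IsSupportingLineAt C W p)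
    (ξ₁ : Circle → ℙ ℝ (Fin 3 → ℝ))
    (hξ₁ : ∃ e : Circle ≃ₜ frontier C, ∀ x, (e x : ℙ ℝ (Fin 3 → ℝ)) = ξ₁ x)
    (ξ₂ : Circle → Submodule ℝ (Fin 3 → ℝ))
    (hξ₂ : ∀ x, IsSupportingLineAt C (ξ₂ x) (ξ₁ x)) :
    (∀ x y z : Circle, x ≠ y → x ≠ z → y ≠ z → ξ₂ x ⊓ ξ₂ y ⊓ ξ₂ z = ⊥) ∧
    (∀ x y : Circle, x ≠ y → finrank ℝ ↥(ξ₂ x ⊓ ξ₂ y) = 1) := by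
  obtain ⟨f, hf, hconv⟩ := hCpc
  change Convex ℝ (chartSet f C) at hconv
  obtain ⟨e, he⟩ := hξ₁
  have hinj : ∀ x y, ξ₁ x = ξ₁ y → x = y := by
    intro x y h
    rw [← he, ← he] at h
    exact e.injective (Subtype.ext h)
  have hrep : ∀ x, ∃ (w : Fin 3 → ℝ) (hw : w ≠ 0), f w = 1 ∧ Projectivization.mk ℝ w hw = ξ₁ x := by
    intro x
    have h0 := (ξ₁ x).rep_nonzero
    have h1 : f (ξ₁ x).rep ≠ 0 := by
      apply hf _ h0
      rw [Projectivization.mk_rep]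
      exact frontier_subset_closure (hξ₂ x).2.1
    have h2 : (f (ξ₁ x).rep)⁻¹ • (ξ₁ x).rep ≠ 0 := smul_ne_zero (inv_ne_zero h1) h0
    refine ⟨_, h2, by simp [h1], ?_⟩
    rw [mk_smul_self f _ h0 h1, Projectivization.mk_rep]
  choose w hw0 hfw hmk using hrep
  have hwF : ∀ x, Projectivization.mk ℝ (w x) (hw0 x) ∈ frontier C := fun x => by
    rw [hmk]; exact (hξ₂ x).2.1
  have hwW : ∀ x, w x ∈ ξ₂ x := fun x => by
    rw [← mk_mem_line _ _ (hw0 x), hmk]; exact (hξ₂ x).2.2.1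
  have hwinj : ∀ x y, x ≠ y → w x ≠ w y := by
    intro x y hxy h
    apply hxy
    apply hinj
    rw [← hmk, ← hmk]
    simp only [h]
  have hnot : ∀ x y, x ≠ y → w y ∉ ξ₂ x := fun x y hxy h =>
    no_two f C hCopen hconv hstrict (ξ₂ x) (hξ₂ x).1 (hξ₂ x).2.2.2 (w x) (w y) (hw0 x) (hw0 y)
      (hfw x) (hfw y) (hwF x) (hwF y) (hwinj x y hxy) (hwW x) h
  have hfun := fun x => exists_functional f C hconv (ξ₂ x) (hξ₂ x).1 (hξ₂ x).2.2.2
  choose φ hker hnn using hfun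
  have hzero : ∀ x, φ x (w x) = 0 := fun x => by
    have := hwW x
    rw [← hker] at this
    exact this
  have hpos : ∀ x y, x ≠ y → 0 < φ x (w y) := by
    intro x y hxy
    refine lt_of_le_of_ne (hnn x _ (mem_closure_chart f C _ (hw0 y) (hfw y)
      (frontier_subset_closure (hwF y)))) (fun h => hnot x y hxy ?_)
    rw [← hker]
    exact h.symm
  have hdim : ∀ x y : Circle, x ≠ y → finrank ℝ ↥(ξ₂ x ⊓ ξ₂ y) = 1 := by
    intro x y hxy
    have h1 := Submodule.finrank_sup_add_finrank_inf_eq (ξ₂ x) (ξ₂ y)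
    rw [(hξ₂ x).1, (hξ₂ y).1] at h1
    have h2 : ξ₂ x < ξ₂ x ⊔ ξ₂ y := by
      refine lt_of_le_of_ne le_sup_left (fun h => hnot x y hxy ?_)
      rw [h]
      exact Submodule.mem_sup_right (hwW y)
    have h3 := Submodule.finrank_lt_finrank_of_lt h2
    rw [(hξ₂ x).1] at h3
    have h4 := Submodule.finrank_le (ξ₂ x ⊔ ξ₂ y)
    simp at h4
    omega
  refine ⟨?_, hdim⟩
  intro x y z hxy hxz hyz
  rw [Submodule.eq_bot_iff]
  intro v hv
  by_contra hv0
  obtain ⟨⟨hvx, hvy⟩, hvz⟩ := hv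
  have hle : ξ₂ x ⊓ ξ₂ y ≤ ξ₂ z := by
    intro u hu
    have h1 := (finrank_eq_one_iff_of_nonzero' (⟨v, hvx, hvy⟩ : ↥(ξ₂ x ⊓ ξ₂ y))
      (fun h => hv0 (congrArg Subtype.val h))).1 (hdim x y hxy) ⟨u, hu⟩
    obtain ⟨c, hc⟩ := h1
    have : c • v = u := congrArg Subtype.val hc
    rw [← this]
    exact (ξ₂ z).smul_mem _ hvz
  have hspan : φ z ∈ Submodule.span ℝ (Set.range ![φ x, φ y]) := by
    apply mem_span_of_iInf_ker_le_ker
    intro u hu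
    rw [hker]
    apply hle
    rw [Submodule.mem_iInf] at hu
    have a := hu 0
    have b := hu 1
    simp only [Matrix.cons_val_zero, Matrix.cons_val_one] at a b
    rw [hker] at a b
    exact ⟨a, b⟩
  rw [Matrix.range_cons, Matrix.range_cons, Matrix.range_empty, Set.union_empty,
    Set.singleton_union, Submodule.mem_span_pair] at hspan
  obtain ⟨a, b, hab⟩ := hspan
  have hev : ∀ u, φ z u = a * φ x u + b * φ y u := fun u => by rw [← hab]; simp
  have ex := hev (w x)
  have ey := hev (w y)
  have ez := hev (w z)
  rw [hzero] at ex ey ez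
  have b0 : 0 < b := by
    have h1 := hpos z x hxz.symm
    have h2 := hpos y x hxy.symm
    rw [ex] at h1
    nlinarith
  have a0 : 0 < a := by
    have h1 := hpos z y hyz.symm
    have h2 := hpos x y hxy
    rw [ey] at h1
    nlinarith
  have h1 := mul_pos a0 (hpos x z hxz)
  have h2 := mul_pos b0 (hpos y z hyz)
  linarith

end CFF
end
end

section
/- Fix x ∈ S¹ and let ℙ(ξ²(x)) = {p ∈ ℙ(ℝ³) : p ⊆ ξ²(x)} with the subspace topology. The map η_x : S¹ → ℙ(ξ²(x)) defined by η_x(y) = the 1-dimensional subspace ξ²(y) ∩ ξ²(x) for y ≠ x, and η_x(x) = ξ¹(x), is well defined and is a homeomorphism of S¹ onto ℙ(ξ²(x)). -/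
noncomputable section

open Filter Topology Module
open scoped LinearAlgebra.Projectivization

namespace CFF

abbrev V3 := Fin 3 → ℝ

/-- the cone over a subset of the projective plane -/
def cone (C : Set (ℙ ℝ V3)) : Set V3 := {v | ∃ hv : v ≠ 0, Projectivization.mk ℝ v hv ∈ C}

lemma isQuotientMap_mk' : IsQuotientMap (Projectivization.mk' ℝ : {v : V3 // v ≠ 0} → ℙ ℝ V3) :=
  isQuotientMap_quotient_mk'

lemma isOpen_cone {C : Set (ℙ ℝ V3)} (hC : IsOpen C) : IsOpen (cone C) := by
  have h : cone C = Subtype.val '' ((Projectivization.mk' ℝ : {v : V3 // v ≠ 0} → ℙ ℝ V3) ⁻¹' C) := by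
    ext v
    simp [cone]
  rw [h]
  refine IsOpen.isOpenMap_subtype_val ?_ _ (hC.preimage isQuotientMap_mk'.continuous)
  exact isOpen_ne

lemma mk_mem_closure {C : Set (ℙ ℝ V3)} {w : V3} (hw : w ≠ 0) {K : Set V3} (hK : K ⊆ cone C)
    (h : w ∈ closure K) : Projectivization.mk ℝ w hw ∈ closure C := by
  rw [mem_closure_iff]
  intro U hU hwU
  have := isOpen_cone hU
  rw [mem_closure_iff] at h
  obtain ⟨z, ⟨hz, hzU⟩, hzK⟩ := h _ this ⟨hw, hwU⟩
  obtain ⟨hz', hzC⟩ := hK hzK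
  exact ⟨_, hzU, hzC⟩

lemma cone_smul {C : Set (ℙ ℝ V3)} {v : V3} (hv : v ∈ cone C) {t : ℝ} (ht : t ≠ 0) :
    t • v ∈ cone C := by
  obtain ⟨h0, hC⟩ := hv
  refine ⟨smul_ne_zero ht h0, ?_⟩
  convert hC using 1
  rw [Projectivization.mk_eq_mk_iff']
  exact ⟨t, rfl⟩

lemma mk_le {v : V3} (hv : v ≠ 0) {W : Submodule ℝ V3} :
    (Projectivization.mk ℝ v hv).submodule ≤ W ↔ v ∈ W := by
  rw [Projectivization.submodule_mk, Submodule.span_singleton_le_iff_mem]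

lemma isCompact_projLine (W : Submodule ℝ V3) : IsCompact (projLine W) := by
  have h1 : IsCompact (Metric.sphere (0 : V3) 1 ∩ W) :=
    (isCompact_sphere _ _).inter_right W.closed_of_finiteDimensional
  have hne : ∀ v : (Metric.sphere (0 : V3) 1 ∩ W : Set V3), (v : V3) ≠ 0 := by
    rintro ⟨v, hv, hvW⟩ h
    have h1 : ‖v‖ = 1 := by simpa using hv
    simp [show v = 0 from h] at h1
  have h2 : projLine W = Set.range (fun v : (Metric.sphere (0 : V3) 1 ∩ W : Set V3) =>
      Projectivization.mk' ℝ ⟨(v : V3), hne v⟩) := by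
    ext p
    induction p using Projectivization.ind with | h v hv =>
    simp only [projLine, Set.mem_ofPred_eq, mk_le, Set.mem_range]
    constructor
    · intro h
      have hn : ‖v‖ ≠ 0 := norm_ne_zero_iff.2 hv
      refine ⟨⟨‖v‖⁻¹ • v, ?_, W.smul_mem _ h⟩, ?_⟩
      · simp [norm_smul, hn]
      · simp only [Projectivization.mk'_eq_mk]
        rw [Projectivization.mk_eq_mk_iff']
        exact ⟨_, rfl⟩
    · rintro ⟨⟨w, hw, hwW⟩, h⟩
      simp only [Projectivization.mk'_eq_mk] at h
      rw [Projectivization.mk_eq_mk_iff'] at h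
      obtain ⟨a, ha⟩ := h
      have hw0 : w ≠ 0 := hne ⟨w, hw, hwW⟩
      have : a ≠ 0 := by rintro rfl; simp at ha; exact hw0 ha.symm
      rw [← W.smul_mem_iff this, ha]; exact hwW
  rw [h2]
  have : CompactSpace (Metric.sphere (0 : V3) 1 ∩ W : Set V3) := isCompact_iff_compactSpace.1 h1
  apply isCompact_range
  refine isQuotientMap_mk'.continuous.comp ?_
  exact Continuous.subtype_mk continuous_subtype_val _

/-- normalised representative -/
def nrm (f : V3 →ₗ[ℝ] ℝ) (q : ℙ ℝ V3) : V3 := (f q.rep)⁻¹ • q.rep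

lemma nrm_mk (f : V3 →ₗ[ℝ] ℝ) {v : V3} (hv : v ≠ 0) :
    nrm f (Projectivization.mk ℝ v hv) = (f v)⁻¹ • v := by
  obtain ⟨a, ha⟩ := Projectivization.exists_smul_eq_mk_rep ℝ v hv
  have ha0 : (a : ℝ) ≠ 0 := a.ne_zero
  rw [nrm, ← ha, Units.smul_def, map_smul, smul_smul, smul_eq_mul, mul_inv]
  congr 1
  field_simp

lemma lin_cont (f : V3 →ₗ[ℝ] ℝ) : Continuous f := f.continuous_of_finiteDimensional

lemma nrm_continuousOn (f : V3 →ₗ[ℝ] ℝ) : ContinuousOn (nrm f) {q | f q.rep ≠ 0} := by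
  have key : (Projectivization.mk' ℝ : {v : V3 // v ≠ 0} → ℙ ℝ V3) ⁻¹' {q | f q.rep ≠ 0}
      = {v : {v : V3 // v ≠ 0} | f v ≠ 0} := by
    ext ⟨v, hv⟩
    obtain ⟨a, ha⟩ := Projectivization.exists_smul_eq_mk_rep ℝ v hv
    have ha0 : (a : ℝ) ≠ 0 := a.ne_zero
    simp [← ha, Units.smul_def]
  have hc : Continuous (fun v : {v : V3 // v ≠ 0} => f v) := (lin_cont f).comp continuous_subtype_val
  rw [isQuotientMap_mk'.continuousOn_isOpen_iff, key]
  · have : nrm f ∘ (Projectivization.mk' ℝ : {v : V3 // v ≠ 0} → ℙ ℝ V3)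
      = fun v : {v : V3 // v ≠ 0} => (f v)⁻¹ • (v : V3) := by
      ext1 ⟨v, hv⟩
      simp [nrm_mk]
    rw [this]
    exact (hc.continuousOn.inv₀ (fun v hv => hv)).smul continuous_subtype_val.continuousOn
  · rw [← isQuotientMap_mk'.isOpen_preimage, key]
    exact isOpen_ne_fun hc continuous_const

/-- triple product -/
def D3 (a b c : V3) : ℝ :=
  a 0 * (b 1 * c 2 - b 2 * c 1) - a 1 * (b 0 * c 2 - b 2 * c 0) + a 2 * (b 0 * c 1 - b 1 * c 0)

lemma cramer3 (a b c u : V3) :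
    D3 a b c • u = D3 u b c • a + D3 a u c • b + D3 a b u • c := by
  ext i
  fin_cases i <;> simp [D3] <;> ring

lemma D3_swap (a b c : V3) : D3 a b c = - D3 a c b := by simp [D3]; ring

/-- triple product as functional -/
def D3l (a b : V3) : V3 →ₗ[ℝ] ℝ where
  toFun := D3 a b
  map_add' := by intro x y; simp [D3]; ring
  map_smul' := by intro x y; simp [D3]; ring

lemma parallel_of_D3 (f a : V3 →ₗ[ℝ] ℝ) {p v w : V3} (h : D3 p v w = 0) (hp : a p = 0)
    (hw : a w = 0) (hv : a v ≠ 0) (hfw : f w = 1) : p = f p • w := by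
  have h1 : ∀ u, D3 p u w = 0 := by
    intro u
    have := congrArg a (cramer3 p v w u)
    simp [h, hp, hw, hv] at this
    exact this
  have e0 := h1 (Pi.single 0 1)
  have e1 := h1 (Pi.single 1 1)
  have e2 := h1 (Pi.single 2 1)
  simp [D3] at e0 e1 e2
  have hf : ∀ z, f z = z 0 * f (Pi.single 0 1) + z 1 * f (Pi.single 1 1) + z 2 * f (Pi.single 2 1) := by
    intro z
    conv_lhs => rw [show z = z 0 • Pi.single 0 1 + z 1 • Pi.single 1 1 + z 2 • Pi.single 2 1 by
      ext i; fin_cases i <;> simp]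
    simp only [map_add, map_smul, smul_eq_mul]
  have hh : f w • p = f p • w := by
    rw [hf w, hf p]
    ext i
    fin_cases i <;> simp <;> grind
  rw [hfw, one_smul] at hh
  exact hh

lemma three_zero {a b c m n o p q r : ℝ} (hm : 0 < m) (hn : 0 < n) (ho : 0 < o) (hp : 0 < p)
    (hq : 0 < q) (hr : 0 < r) (h1 : b * m + c * n = 0) (h2 : a * o + c * p = 0)
    (h3 : a * q + b * r = 0) : a = 0 ∧ b = 0 ∧ c = 0 := by
  have ha : a = 0 := by
    have hb : b = -(a*q)/r := by field_simp; linarith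
    have hc : c = -(a*o)/p := by field_simp; linarith
    rw [hb, hc] at h1
    field_simp at h1
    have : a * (m * q * p + n * o * r) = 0 := by linarith
    rcases mul_eq_zero.1 this with h | h
    · exact h
    · have : 0 < m * q * p + n * o * r := by positivity
      linarith
  subst ha
  simp at h2 h3
  exact ⟨rfl, h3.resolve_right hr.ne', h2.resolve_right hp.ne'⟩

lemma exists_functional_s1 {W : Submodule ℝ V3} (hW : finrank ℝ W = 2) :
    ∃ a : V3 →ₗ[ℝ] ℝ, a ≠ 0 ∧ LinearMap.ker a = W := by
  have hlt : W < ⊤ := by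
    rw [lt_top_iff_ne_top]
    rintro rfl
    simp at hW
  obtain ⟨a, ha, hle⟩ := W.exists_le_ker_of_lt_top hlt
  refine ⟨a, ha, ?_⟩
  symm
  apply Submodule.eq_of_le_of_finrank_le hle
  have h1 := a.finrank_range_add_finrank_ker
  have h2 : 0 < finrank ℝ (LinearMap.range a) := by
    rw [Module.finrank_pos_iff_exists_ne_zero]
    by_contra hcon
    push Not at hcon
    apply ha
    ext1 i
    ext
    have := hcon ⟨_, LinearMap.mem_range_self a (Pi.single i 1)⟩
    simpa using this
  simp at h1
  omega

lemma finrank_ker {a : V3 →ₗ[ℝ] ℝ} (ha : a ≠ 0) : finrank ℝ (LinearMap.ker a) = 2 := by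
  have h1 := a.finrank_range_add_finrank_ker
  have h2 : LinearMap.range a = ⊤ := by
    rw [LinearMap.range_eq_top]
    exact LinearMap.surjective ha
  rw [h2] at h1
  simp at h1
  omega

lemma facts
    (C : Set (ℙ ℝ (Fin 3 → ℝ))) (hCopen : IsOpen C) (hCpc : ProperlyConvex C)
    (hstrict : StrictlyConvexBoundary C)
    (hC1 : ∀ p ∈ frontier C, ∃! W : Submodule ℝ (Fin 3 → ℝ), IsSupportingLineAt C W p)
    (ξ₁ : Circle → ℙ ℝ (Fin 3 → ℝ))
    (hξ₁ : ∃ e : Circle ≃ₜ frontier C, ∀ x, (e x : ℙ ℝ (Fin 3 → ℝ)) = ξ₁ x)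
    (ξ₂ : Circle → Submodule ℝ (Fin 3 → ℝ))
    (hξ₂ : ∀ x, IsSupportingLineAt C (ξ₂ x) (ξ₁ x)) :
    ∃ (f : V3 →ₗ[ℝ] ℝ) (u : Circle → V3) (A : Circle → V3 →ₗ[ℝ] ℝ) (v0 : V3),
      Continuous u ∧ (∀ y, f (u y) = 1) ∧
      (∀ y, ∃ h : u y ≠ 0, Projectivization.mk ℝ (u y) h = ξ₁ y) ∧
      (∀ y, LinearMap.ker (A y) = ξ₂ y) ∧ (∀ y, 0 < A y v0) ∧
      (∀ y z, z ≠ y → 0 < A y (u z)) ∧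
      (∀ x p, p ≠ 0 → A x p = 0 → (∀ t : ℝ, p ≠ t • u x) → ∃ y, y ≠ x ∧ A y p = 0) ∧
      (∀ y p, A y p = 0 ↔ ∀ α β : ℝ, α • p + β • u y ∉ cone C) := by
  obtain ⟨f, hf, hconv⟩ := hCpc
  obtain ⟨e, he⟩ := hξ₁
  set K : Set V3 := {w : V3 | f w = 1 ∧ ∃ hw : w ≠ 0, Projectivization.mk ℝ w hw ∈ C} with hK
  have hKcone : K ⊆ cone C := fun w hw => hw.2
  have hrep : ∀ q ∈ closure C, f q.rep ≠ 0 := fun q hq =>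
    hf q.rep q.rep_nonzero (by rwa [Projectivization.mk_rep])
  have hcl : ContinuousOn (nrm f) (closure C) := (nrm_continuousOn f).mono hrep
  have hnf : ∀ q ∈ closure C, f (nrm f q) = 1 := fun q hq => by
    simp [nrm, hrep q hq]
  have hn0 : ∀ q ∈ closure C, nrm f q ≠ 0 := fun q hq h => by
    have := hnf q hq
    simp [h] at this
  have hnmk : ∀ q (hq : q ∈ closure C), Projectivization.mk ℝ (nrm f q) (hn0 q hq) = q := by
    intro q hq
    conv_rhs => rw [← Projectivization.mk_rep q]
    rw [Projectivization.mk_eq_mk_iff']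
    exact ⟨_, rfl⟩
  have hnC : ∀ q ∈ C, nrm f q ∈ K := fun q hq =>
    ⟨hnf q (subset_closure hq), hn0 q (subset_closure hq), by rwa [hnmk q (subset_closure hq)]⟩
  have hnCl : ∀ q ∈ closure C, nrm f q ∈ closure K := fun q hq =>
    closure_mono (by rintro _ ⟨q, hq, rfl⟩; exact hnC q hq) (hcl.image_closure (Set.mem_image_of_mem _ hq))
  have hKf : ∀ w ∈ closure K, f w = 1 := by
    intro w hw
    have hcl : IsClosed {w | f w = 1} := isClosed_eq (lin_cont f) continuous_const
    exact hcl.closure_subset_iff.2 (fun w hw => hw.1) hw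
  have hK0 : ∀ w ∈ closure K, w ≠ 0 := fun w hw h => by
    have := hKf w hw
    simp [h] at this
  have hKC : ∀ w (hw : w ∈ closure K), Projectivization.mk ℝ w (hK0 w hw) ∈ closure C :=
    fun w hw => mk_mem_closure _ hKcone hw
  have hKcomp : IsCompact (closure K) := by
    have : closure K = nrm f '' closure C := by
      apply Set.Subset.antisymm
      · intro w hw
        refine ⟨_, hKC w hw, ?_⟩
        rw [nrm_mk, hKf w hw]
        simp
      · exact Set.image_subset_iff.2 hnCl
    rw [this]
    refine IsCompact.image_of_continuousOn ?_ hcl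
    have h1 : IsCompact (Set.univ : Set (ℙ ℝ V3)) := by
      have := isCompact_projLine ⊤
      convert this
      ext p; simp [projLine]
    exact h1.of_isClosed_subset isClosed_closure (Set.subset_univ _)
  have hKcl : Convex ℝ (closure K) := hconv.closure
  -- the points
  set u : Circle → V3 := fun y => nrm f (ξ₁ y) with hu
  have hfr : ∀ y, ξ₁ y ∈ frontier C := fun y => by rw [← he]; exact (e y).2
  have hfrcl : ∀ y, ξ₁ y ∈ closure C := fun y => frontier_subset_closure (hfr y)
  have hucont : Continuous u := by
    have h1 : Continuous ξ₁ := by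
      have : ξ₁ = fun y => ((e y : frontier C) : ℙ ℝ V3) := by ext1 y; exact (he y).symm
      rw [this]
      exact continuous_subtype_val.comp e.continuous
    exact hcl.comp_continuous h1 hfrcl
  have huf : ∀ y, f (u y) = 1 := fun y => hnf _ (hfrcl y)
  have hu0 : ∀ y, u y ≠ 0 := fun y => hn0 _ (hfrcl y)
  have humk : ∀ y, Projectivization.mk ℝ (u y) (hu0 y) = ξ₁ y := fun y => hnmk _ (hfrcl y)
  have huK : ∀ y, u y ∈ closure K := fun y => hnCl _ (hfrcl y)
  have hξinj : Function.Injective ξ₁ := by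
    intro y z h
    apply e.injective
    apply Subtype.ext
    rw [he, he, h]
  have huinj : Function.Injective u := by
    intro y z h
    apply hξinj
    rw [← humk y, ← humk z]
    simp only [h]
  have hsurj : ∀ w (hw : w ∈ closure K), Projectivization.mk ℝ w (hK0 w hw) ∉ C → ∃ y, u y = w := by
    intro w hw hwC
    have : Projectivization.mk ℝ w (hK0 w hw) ∈ frontier C := by
      rw [frontier, hCopen.interior_eq]
      exact ⟨hKC w hw, hwC⟩
    refine ⟨e.symm ⟨_, this⟩, ?_⟩
    simp only [hu]
    rw [← he, e.apply_symm_apply]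
    simp only
    rw [nrm_mk, hKf w hw]; simp
  obtain ⟨v0, hv0⟩ : K.Nonempty := by
    have h1 : (closure C).Nonempty := ⟨_, hfrcl 1⟩
    rw [closure_nonempty_iff] at h1
    obtain ⟨q, hq⟩ := h1
    exact ⟨_, hnC q hq⟩
  -- functionals
  have hA : ∀ y, ∃ a : V3 →ₗ[ℝ] ℝ, LinearMap.ker a = ξ₂ y ∧ ∀ w ∈ K, 0 < a w := by
    intro y
    obtain ⟨h2, -, -, hdis⟩ := hξ₂ y
    obtain ⟨a, ha0, ha⟩ := exists_functional_s1 h2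
    have hne : ∀ w ∈ K, a w ≠ 0 := by
      rintro w ⟨hw1, hw0, hwC⟩ h
      have : Projectivization.mk ℝ w hw0 ∈ projLine (ξ₂ y) ∩ C := by
        refine ⟨?_, hwC⟩
        rw [projLine, Set.mem_ofPred_eq, mk_le, ← ha]
        exact h
      rw [hdis] at this
      exact this
    have hsign : ∀ (b : V3 →ₗ[ℝ] ℝ), (∀ w ∈ K, b w ≠ 0) → 0 < b v0 → ∀ w ∈ K, 0 < b w := by
      intro b hb hb0 w hw
      by_contra hcon
      push Not at hcon
      have h1 := hconv.isPreconnected.image b (lin_cont b).continuousOn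
      have h2 := h1.ordConnected.out (Set.mem_image_of_mem b hw) (Set.mem_image_of_mem b hv0)
        ⟨hcon, hb0.le⟩
      obtain ⟨z, hz, hz0⟩ := h2
      exact hb z hz hz0
    rcases lt_or_gt_of_ne (hne v0 hv0) with h | h
    · refine ⟨-a, ?_, hsign (-a) (fun w hw => by simpa using hne w hw) (by simpa using h)⟩
      rw [← ha]; ext; simp
    · exact ⟨a, ha, hsign a hne h⟩
  choose A hAker hApos using hA
  have hAnn : ∀ y, ∀ w ∈ closure K, 0 ≤ A y w := by
    intro y w hw
    have hcl : IsClosed {w | 0 ≤ A y w} := isClosed_le continuous_const (lin_cont _)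
    exact hcl.closure_subset_iff.2 (fun w hw => (hApos y w hw).le) hw
  have hAu : ∀ y, A y (u y) = 0 := by
    intro y
    have := (hξ₂ y).2.2.1
    rw [← humk, mk_le, ← hAker] at this
    exact this
  have hAz : ∀ y, ∀ w ∈ closure K, A y w = 0 → w = u y := by
    intro y w hw h0
    have key : ∀ w (hw : w ∈ closure K), A y w = 0 → Projectivization.mk ℝ w (hK0 w hw) ∉ C := by
      intro w hw h hC
      exact (hApos y w ⟨hKf w hw, _, hC⟩).ne' h
    by_contra hne
    obtain ⟨z, rfl⟩ := hsurj w hw (key w hw h0)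
    set m : V3 := (1/2 : ℝ) • u z + (1/2 : ℝ) • u y with hm
    have hmK : m ∈ closure K := hKcl hw (huK y) (by norm_num) (by norm_num) (by norm_num)
    have hmA : A y m = 0 := by simp [hm, h0, hAu]
    obtain ⟨t, ht⟩ := hsurj m hmK (key m hmK hmA)
    have hzy : z ≠ y := fun h => hne (by rw [h])
    have htz : z ≠ t := by
      rintro rfl
      apply hne
      have h1 : (1/2 : ℝ) • u z = (1/2 : ℝ) • u y := by
        have h2 : u z = (1/2 : ℝ) • u z + (1/2 : ℝ) • u z := by rw [← add_smul]; norm_num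
        rw [hm] at ht
        exact add_left_cancel (h2.symm.trans ht)
      exact smul_right_injective _ (by norm_num : (1/2 : ℝ) ≠ 0) h1
    have hty : y ≠ t := by
      rintro rfl
      apply hne
      have h1 : (1/2 : ℝ) • u y = (1/2 : ℝ) • u z := by
        have h2 : u y = (1/2 : ℝ) • u y + (1/2 : ℝ) • u y := by rw [← add_smul]; norm_num
        rw [hm] at ht
        exact add_right_cancel (h2.symm.trans ht)
      exact (smul_right_injective _ (by norm_num : (1/2 : ℝ) ≠ 0) h1).symm
    have hmem : ∀ z, A y (u z) = 0 → (ξ₁ z).submodule ≤ ξ₂ y := by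
      intro z hz
      rw [← humk, mk_le, ← hAker]; exact hz
    exact hstrict (ξ₁ z) (ξ₁ y) (ξ₁ t) (hfr _) (hfr _) (hfr _) (hξinj.ne hzy) (hξinj.ne htz)
      (hξinj.ne hty) (ξ₂ y) (hξ₂ y).1 ⟨hmem _ h0, hmem _ (hAu y), hmem _ (by rw [ht]; exact hmA)⟩
  have huniq : ∀ y W, IsSupportingLineAt C W (ξ₁ y) → W = ξ₂ y := fun y W hW =>
    (hC1 _ (hfr y)).unique hW (hξ₂ y)
  refine ⟨f, u, A, v0, hucont, huf, fun y => ⟨hu0 y, humk y⟩, hAker, fun y => hApos y v0 hv0,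
    ?_, ?_, ?_⟩
  · intro y z hzy
    refine lt_of_le_of_ne (hAnn y _ (huK z)) ?_
    intro h
    exact hzy (huinj (hAz y _ (huK z) h.symm))
  · intro x p hp0 hp hpx
    obtain ⟨g, hgp, hgv, hgx⟩ : ∃ g : V3 →ₗ[ℝ] ℝ, g p = 0 ∧ g v0 = 0 ∧ 0 < g (u x) := by
      have h1 : D3l p v0 p = 0 := by simp [D3l, D3]; ring
      have h2 : D3l p v0 v0 = 0 := by simp [D3l, D3]; ring
      have h3 : D3l p v0 (u x) ≠ 0 := fun h =>
        hpx _ (parallel_of_D3 f (A x) h hp (hAu x) (hApos x v0 hv0).ne' (huf x))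
      rcases lt_or_gt_of_ne h3 with h | h
      · exact ⟨-D3l p v0, by simp [h1], by simp [h2], by simpa using h⟩
      · exact ⟨_, h1, h2, h⟩
    set L : Set V3 := closure K ∩ {w | g w ≤ 0} with hL
    have hLc : IsCompact L := hKcomp.inter_right (isClosed_le (lin_cont g) continuous_const)
    have hApL : ∀ w ∈ L, 0 < A x w := by
      rintro w ⟨hw, hgw⟩
      refine lt_of_le_of_ne (hAnn x w hw) ?_
      intro h
      have := hAz x w hw h.symm
      subst this
      exact absurd hgx (not_lt.2 hgw)
    obtain ⟨q, hqL, hqmax⟩ := hLc.exists_isMaxOn ⟨v0, subset_closure hv0, hgv.le⟩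
      (f := fun w => -g w / A x w)
      ((lin_cont g).neg.continuousOn.div (lin_cont _).continuousOn (fun w hw => (hApL w hw).ne'))
    set t := -g q / A x q with ht
    have ht0 : 0 ≤ t := div_nonneg (by have := hqL.2; simp at this; linarith) (hApL q hqL).le
    set h : V3 →ₗ[ℝ] ℝ := g + t • A x with hh
    have hhq : h q = 0 := by
      have := (hApL q hqL).ne'
      simp [hh, ht]
      field_simp
      ring
    have hhn : ∀ w ∈ closure K, 0 ≤ h w := by
      intro w hw
      simp only [hh, LinearMap.add_apply, LinearMap.smul_apply, smul_eq_mul]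
      by_cases hgw : g w ≤ 0
      · have hwL : w ∈ L := ⟨hw, hgw⟩
        have h1 : -g w / A x w ≤ t := hqmax hwL
        rw [div_le_iff₀ (hApL w hwL)] at h1
        linarith
      · have := mul_nonneg ht0 (hAnn x w hw)
        linarith
    have hhx : 0 < h (u x) := by
      simp [hh, hAu, hgx]
    have hhp : h p = 0 := by simp [hh, hgp, hp]
    have hhC : ∀ w ∈ cone C, h w ≠ 0 := by
      intro w hw hw0
      have hfw : f w ≠ 0 := by
        obtain ⟨hw1, hw2⟩ := hw
        exact hf w hw1 (subset_closure hw2)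
      set c := (f w)⁻¹ • w with hc
      have hcC : c ∈ cone C := cone_smul hw (inv_ne_zero hfw)
      have hc0 : h c = 0 := by simp [hc, hw0]
      have hfc : f c = 1 := by simp [hc, hfw]
      have hcts : Continuous (fun ε : ℝ => c - ε • u x) := by fun_prop
      have hev : ∀ᶠ ε in 𝓝 (0:ℝ), c - ε • u x ∈ cone C :=
        hcts.continuousAt.eventually_mem ((isOpen_cone hCopen).mem_nhds (by simpa using hcC))
      have hev2 : ∀ᶠ ε in 𝓝 (0:ℝ), ε < 1 := gt_mem_nhds (by norm_num)
      have hev3 : ∀ᶠ ε in 𝓝[>] (0:ℝ), c - ε • u x ∈ cone C ∧ ε < 1 ∧ 0 < ε := by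
        filter_upwards [nhdsWithin_le_nhds hev, nhdsWithin_le_nhds hev2, self_mem_nhdsWithin]
          with ε h1 h2 h3 using ⟨h1, h2, h3⟩
      obtain ⟨ε, h1, h2, h3⟩ := hev3.exists
      have hε : 0 < (1 - ε) := by linarith
      have hmem : (1 - ε)⁻¹ • (c - ε • u x) ∈ K := by
        refine ⟨?_, cone_smul h1 (inv_ne_zero hε.ne')⟩
        simp [hfc, huf, hε.ne']
      have h4 := hhn _ (subset_closure hmem)
      simp only [map_smul, map_sub, hc0, smul_eq_mul] at h4
      have : 0 < (1 - ε)⁻¹ * (ε * h (u x)) := by positivity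
      linarith
    have hh0 : h ≠ 0 := by
      intro h0
      simp [h0] at hhx
    obtain ⟨y, hy⟩ := hsurj q hqL.1 (fun hC => hhC q ⟨_, hC⟩ hhq)
    have hsup : IsSupportingLineAt C (LinearMap.ker h) (ξ₁ y) := by
      refine ⟨finrank_ker hh0, hfr y, ?_, ?_⟩
      · rw [← humk, mk_le, hy]
        exact hhq
      · rw [Set.eq_empty_iff_forall_notMem]
        rintro p' ⟨h1, h2⟩
        induction p' using Projectivization.ind with | h v hv =>
        rw [projLine, Set.mem_ofPred_eq, mk_le] at h1
        exact hhC v ⟨hv, h2⟩ h1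
    have hker := (huniq y _ hsup).trans (hAker y).symm
    refine ⟨y, ?_, ?_⟩
    · rintro rfl
      rw [hy] at hhx
      exact hhx.ne' hhq
    · have : p ∈ LinearMap.ker h := hhp
      rw [hker] at this
      exact this
  · intro y p
    constructor
    · rintro h α β ⟨h0, hC⟩
      have h1 : Projectivization.mk ℝ _ h0 ∈ projLine (ξ₂ y) ∩ C := by
        refine ⟨?_, hC⟩
        rw [projLine, Set.mem_ofPred_eq, mk_le, ← hAker]
        simp [h, hAu]
      rw [(hξ₂ y).2.2.2] at h1
      exact h1
    · intro h
      by_contra hne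
      have hli : LinearIndependent ℝ ![p, u y] := by
        rw [LinearIndependent.pair_iff]
        intro s t hst
        have h1 := congrArg (A y) hst
        simp [hAu, hne] at h1
        subst h1
        simpa [hu0] using hst
      have hsup : IsSupportingLineAt C (Submodule.span ℝ {p, u y}) (ξ₁ y) := by
        refine ⟨?_, hfr y, ?_, ?_⟩
        · have := finrank_span_eq_card hli
          rw [Matrix.range_cons_cons_empty] at this
          simpa using this
        · rw [← humk, mk_le]
          exact Submodule.subset_span (by simp)
        · rw [Set.eq_empty_iff_forall_notMem]
          rintro p' ⟨h1, h2⟩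
          induction p' using Projectivization.ind with | h v hv =>
          rw [projLine, Set.mem_ofPred_eq, mk_le, Submodule.mem_span_pair] at h1
          obtain ⟨α, β, rfl⟩ := h1
          exact h α β ⟨hv, h2⟩
      have hker := (huniq y _ hsup).trans (hAker y).symm
      apply hne
      have : p ∈ Submodule.span ℝ {p, u y} := Submodule.subset_span (by simp)
      rw [hker] at this
      exact this

/-- For fixed `x`, the map `η_x` sending `y ≠ x` to the point
`ξ²(y) ∩ ξ²(x)` and `x` to `ξ¹(x)` is well defined and a homeomorphism of the circle onto the
projective line `ℙ(ξ²(x))`. -/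
theorem statement_1
    (C : Set (ℙ ℝ (Fin 3 → ℝ))) (hCopen : IsOpen C) (hCpc : ProperlyConvex C)
    (hstrict : StrictlyConvexBoundary C)
    (hC1 : ∀ p ∈ frontier C, ∃! W : Submodule ℝ (Fin 3 → ℝ), IsSupportingLineAt C W p)
    (ξ₁ : Circle → ℙ ℝ (Fin 3 → ℝ))
    (hξ₁ : ∃ e : Circle ≃ₜ frontier C, ∀ x, (e x : ℙ ℝ (Fin 3 → ℝ)) = ξ₁ x)
    (ξ₂ : Circle → Submodule ℝ (Fin 3 → ℝ))
    (hξ₂ : ∀ x, IsSupportingLineAt C (ξ₂ x) (ξ₁ x))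
    (x : Circle) :
    ∃ η : Circle → ℙ ℝ (Fin 3 → ℝ),
      (∀ y, y ≠ x → (η y).submodule = ξ₂ y ⊓ ξ₂ x) ∧
      η x = ξ₁ x ∧
      ∃ e : Circle ≃ₜ projLine (ξ₂ x), ∀ y, (e y : ℙ ℝ (Fin 3 → ℝ)) = η y := by
  obtain ⟨f, u, A, v0, hucont, huf, humk, hAker, hAv0, hApos, hsurj, hmem⟩ :=
    facts C hCopen hCpc hstrict hC1 ξ₁ hξ₁ ξ₂ hξ₂
  have hAu : ∀ y, A y (u y) = 0 := by
    intro y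
    obtain ⟨h0, h⟩ := humk y
    have := (hξ₂ y).2.2.1
    rw [← h, mk_le, ← hAker] at this
    exact this
  have hrk : ∀ y, y ≠ x → finrank ℝ (ξ₂ y ⊓ ξ₂ x : Submodule ℝ V3) = 1 := by
    intro y hy
    have h1 : finrank ℝ (ξ₂ y ⊔ ξ₂ x : Submodule ℝ V3) + finrank ℝ (ξ₂ y ⊓ ξ₂ x : Submodule ℝ V3)
        = finrank ℝ (ξ₂ y) + finrank ℝ (ξ₂ x) :=
      Submodule.finrank_sup_add_finrank_inf_eq (ξ₂ y) (ξ₂ x)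
    have h5 : finrank ℝ (ξ₂ y) = 2 := (hξ₂ y).1
    have h6 : finrank ℝ (ξ₂ x) = 2 := (hξ₂ x).1
    have h2 : finrank ℝ (ξ₂ y ⊔ ξ₂ x : Submodule ℝ V3) ≤ 3 := by
      simpa using Submodule.finrank_le (ξ₂ y ⊔ ξ₂ x : Submodule ℝ V3)
    have h3 : finrank ℝ (ξ₂ x) < finrank ℝ (ξ₂ y ⊔ ξ₂ x : Submodule ℝ V3) := by
      apply Submodule.finrank_lt_finrank_of_lt
      refine lt_of_le_of_ne le_sup_right ?_
      intro h
      have h4 : u y ∈ ξ₂ x := by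
        rw [h]
        apply Submodule.mem_sup_left
        rw [← hAker]
        exact hAu y
      rw [← hAker] at h4
      exact (hApos x y hy).ne' h4
    omega
  classical
  set η : Circle → ℙ ℝ V3 := fun y =>
    if h : y = x then ξ₁ x else Projectivization.mk'' _ (hrk y h) with hη
  have hηx : η x = ξ₁ x := by simp [hη]
  have hηy : ∀ y, y ≠ x → (η y).submodule = ξ₂ y ⊓ ξ₂ x := by
    intro y hy
    simp [hη, hy]
  have hy_iff : ∀ p (hp : p ≠ 0) y, y ≠ x →
      (Projectivization.mk ℝ p hp = η y ↔ A x p = 0 ∧ A y p = 0) := by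
    intro p hp y hy
    rw [← Projectivization.submodule_injective.eq_iff, hηy y hy]
    constructor
    · intro h
      have h1 : p ∈ ξ₂ y ⊓ ξ₂ x := by
        rw [← mk_le hp, h]
      rw [← hAker, ← hAker] at h1
      exact ⟨h1.2, h1.1⟩
    · rintro ⟨h1, h2⟩
      apply Submodule.eq_of_le_of_finrank_eq
      · rw [mk_le, ← hAker, ← hAker]
        exact ⟨h2, h1⟩
      · rw [hrk y hy, Projectivization.finrank_submodule]
  have hx_iff : ∀ p (hp : p ≠ 0), (Projectivization.mk ℝ p hp = η x ↔ ∃ t : ℝ, p = t • u x) := by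
    intro p hp
    obtain ⟨h0, h⟩ := humk x
    rw [hηx, ← h, Projectivization.mk_eq_mk_iff']
    exact ⟨fun ⟨t, ht⟩ => ⟨t, ht.symm⟩, fun ⟨t, ht⟩ => ⟨t, ht.symm⟩⟩
  have key : ∀ p (hp : p ≠ 0) y, (Projectivization.mk ℝ p hp = η y ↔ A x p = 0 ∧
      (∀ α β : ℝ, α • p + β • u y ∉ cone C) ∧ D3 p v0 (u x) * D3 p v0 (u y) ≤ 0) := by
    intro p hp y
    rw [← hmem]
    by_cases hy : y = x
    · subst hy
      rw [hx_iff]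
      constructor
      · rintro ⟨t, rfl⟩
        refine ⟨by simp [hAu], by simp [hAu], ?_⟩
        have : D3 (t • u y) v0 (u y) = 0 := by simp [D3]; ring
        simp [this]
      · rintro ⟨h1, -, h2⟩
        have h3 : D3 p v0 (u y) = 0 := by nlinarith
        exact ⟨_, parallel_of_D3 f (A y) h3 h1 (hAu y) (hAv0 y).ne' (huf y)⟩
    · rw [hy_iff p hp y hy]
      refine ⟨fun ⟨h1, h2⟩ => ⟨h1, h2, ?_⟩, fun ⟨h1, h2, _⟩ => ⟨h1, h2⟩⟩
      have hc := cramer3 p (u x) (u y) v0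
      have ex := congrArg (A x) hc
      have ey := congrArg (A y) hc
      simp only [map_add, map_smul, smul_eq_mul, h1, h2, hAu, mul_zero, zero_add, add_zero] at ex ey
      have p1 := hApos x y hy
      have p2 := hApos y x (Ne.symm hy)
      have p3 := hAv0 x
      have p4 := hAv0 y
      rw [D3_swap p v0 (u x)]
      set d := D3 p (u x) (u y)
      have e1 : D3 p (u x) v0 = d * A x v0 / A x (u y) := by field_simp; linarith
      have e2 : D3 p v0 (u y) = d * A y v0 / A y (u x) := by field_simp; linarith
      rw [e1, e2]
      have : 0 ≤ (d * d) * (A x v0 * A y v0 / (A x (u y) * A y (u x))) :=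
        mul_nonneg (mul_self_nonneg d) (by positivity)
      calc _ = -((d * d) * (A x v0 * A y v0 / (A x (u y) * A y (u x)))) := by field_simp
        _ ≤ 0 := by linarith
  have hηmem : ∀ y, η y ∈ projLine (ξ₂ x) := by
    intro y
    by_cases hy : y = x
    · subst hy
      rw [hηx]
      exact (hξ₂ y).2.2.1
    · rw [projLine, Set.mem_ofPred_eq, hηy y hy]
      exact inf_le_right
  -- injectivity
  have hxy : ∀ y, y ≠ x → η x ≠ η y := by
    intro y hy h
    obtain ⟨h0, h1⟩ := humk x
    have h2 : Projectivization.mk ℝ (u x) h0 = η y := by rw [h1, ← hηx, h]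
    rw [hy_iff _ _ y hy] at h2
    exact (hApos y x (Ne.symm hy)).ne' h2.2
  have hinj : Function.Injective η := by
    intro y z hyz
    by_contra hne
    by_cases hy : y = x
    · subst hy
      exact hxy z (Ne.symm hne) hyz
    by_cases hz : z = x
    · subst hz
      exact hxy y hne hyz.symm
    obtain ⟨p, hp, hpy⟩ : ∃ p, ∃ hp : p ≠ 0, Projectivization.mk ℝ p hp = η y :=
      ⟨_, _, Projectivization.mk_rep _⟩
    have h1 := (hy_iff p hp y hy).1 hpy
    have h2 := (hy_iff p hp z hz).1 (hpy.trans hyz)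
    have hzero : ∀ a b c : ℝ, A x (a • u x + b • u y + c • u z) = 0 →
        A y (a • u x + b • u y + c • u z) = 0 → A z (a • u x + b • u y + c • u z) = 0 →
        a = 0 ∧ b = 0 ∧ c = 0 := by
      intro a b c e1 e2 e3
      simp only [map_add, map_smul, smul_eq_mul, hAu, mul_zero, zero_add, add_zero] at e1 e2 e3
      exact three_zero (hApos x y hy) (hApos x z hz) (hApos y x (Ne.symm hy))
        (hApos y z (Ne.symm hne)) (hApos z x (Ne.symm hz)) (hApos z y hne) e1 e2 e3
    have hli : LinearIndependent ℝ ![u x, u y, u z] := by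
      rw [Fintype.linearIndependent_iff]
      intro g hg
      simp only [Fin.sum_univ_three, Matrix.cons_val_zero, Matrix.cons_val_one,
        Matrix.cons_val] at hg
      obtain ⟨a1, a2, a3⟩ := hzero (g 0) (g 1) (g 2) (by simp [hg]) (by simp [hg]) (by simp [hg])
      intro i
      fin_cases i <;> assumption
    have hspan := hli.span_eq_top_of_card_eq_finrank (by simp)
    have hpm : p ∈ Submodule.span ℝ (Set.range ![u x, u y, u z]) := by rw [hspan]; trivial
    rw [Submodule.mem_span_range_iff_exists_fun] at hpm
    obtain ⟨g, hg⟩ := hpm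
    simp only [Fin.sum_univ_three, Matrix.cons_val_zero, Matrix.cons_val_one,
        Matrix.cons_val] at hg
    obtain ⟨a1, a2, a3⟩ := hzero (g 0) (g 1) (g 2) (by rw [hg]; exact h1.1)
      (by rw [hg]; exact h1.2) (by rw [hg]; exact h2.2)
    apply hp
    rw [← hg, a1, a2, a3]
    simp
  have hsur : ∀ q ∈ projLine (ξ₂ x), ∃ y, η y = q := by
    intro q hq
    induction q using Projectivization.ind with | h p hp =>
    rw [projLine, Set.mem_ofPred_eq, mk_le, ← hAker] at hq
    by_cases hpx : ∃ t : ℝ, p = t • u x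
    · exact ⟨x, ((hx_iff p hp).2 hpx).symm⟩
    · push Not at hpx
      obtain ⟨y, hy, hyp⟩ := hsurj x p hp hq hpx
      exact ⟨y, ((hy_iff p hp y hy).2 ⟨hq, hyp⟩).symm⟩
  refine ⟨η, hηy, hηx, ?_⟩
  let E : Circle ≃ projLine (ξ₂ x) := Equiv.ofBijective (fun y => ⟨η y, hηmem y⟩)
    ⟨fun y z h => hinj (congrArg Subtype.val h), fun ⟨q, hq⟩ => by
      obtain ⟨y, hy⟩ := hsur q hq
      exact ⟨y, Subtype.ext hy⟩⟩
  have hEη : ∀ y, (E y : ℙ ℝ V3) = η y := fun y => rfl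
  have hclosed : ∀ F : Set Circle, IsClosed F → IsClosed (η '' F) := by
    intro F hF
    rw [← isQuotientMap_mk'.isClosed_preimage]
    have hpre : (Projectivization.mk' ℝ : {v : V3 // v ≠ 0} → ℙ ℝ V3) ⁻¹' (η '' F) =
        Prod.fst '' {z : {v : V3 // v ≠ 0} × Circle | z.2 ∈ F ∧ A x z.1 = 0 ∧
          (∀ α β : ℝ, α • (z.1 : V3) + β • u z.2 ∉ cone C) ∧
          D3 z.1 v0 (u x) * D3 z.1 v0 (u z.2) ≤ 0} := by
      ext ⟨p, hp⟩
      simp only [Set.mem_preimage, Set.mem_image, Projectivization.mk'_eq_mk]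
      constructor
      · rintro ⟨y, hyF, hy⟩
        exact ⟨(⟨p, hp⟩, y), ⟨hyF, (key p hp y).1 hy.symm⟩, rfl⟩
      · rintro ⟨⟨p', y⟩, ⟨hyF, hy⟩, rfl⟩
        exact ⟨y, hyF, ((key p hp y).2 hy).symm⟩
    rw [hpre]
    apply isClosedMap_fst_of_compactSpace
    have c1 : Continuous (fun z : {v : V3 // v ≠ 0} × Circle => (z.1 : V3)) :=
      continuous_subtype_val.comp continuous_fst
    have c2 : Continuous (fun z : {v : V3 // v ≠ 0} × Circle => u z.2) :=
      hucont.comp continuous_snd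
    have d1 : IsClosed {z : {v : V3 // v ≠ 0} × Circle | A x z.1 = 0} :=
      isClosed_eq ((lin_cont _).comp c1) continuous_const
    have d2 : IsClosed (⋂ α : ℝ, ⋂ β : ℝ, {z : {v : V3 // v ≠ 0} × Circle |
          α • (z.1 : V3) + β • u z.2 ∈ (cone C)ᶜ}) := by
      refine isClosed_iInter fun α => isClosed_iInter fun β => ?_
      exact (isOpen_cone hCopen).isClosed_compl.preimage
          ((c1.const_smul α).add (c2.const_smul β))
    have d3 : IsClosed {z : {v : V3 // v ≠ 0} × Circle |
        D3 z.1 v0 (u x) * D3 z.1 v0 (u z.2) ≤ 0} := by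
      refine isClosed_le ?_ continuous_const
      have k1 : ∀ i, Continuous (fun z : {v : V3 // v ≠ 0} × Circle => (z.1 : V3) i) :=
        fun i => (continuous_apply i).comp c1
      have k2 : ∀ i, Continuous (fun z : {v : V3 // v ≠ 0} × Circle => u z.2 i) :=
        fun i => (continuous_apply i).comp c2
      have a0 := k1 0
      have a1 := k1 1
      have a2 := k1 2
      have b0 := k2 0
      have b1 := k2 1
      have b2 := k2 2
      simp only [D3]
      fun_prop
    convert (hF.preimage continuous_snd).inter (d1.inter (d2.inter d3)) using 1
    ext z
    simp
  have hcont : Continuous E.symm := by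
    rw [continuous_iff_isClosed]
    intro F hF
    have : E.symm ⁻¹' F = Subtype.val ⁻¹' (η '' F) := by
      ext q
      obtain ⟨y, rfl⟩ := E.surjective q
      simp [hEη, hinj.eq_iff]
    rw [this]
    exact (hclosed F hF).preimage continuous_subtype_val
  have : CompactSpace (projLine (ξ₂ x)) := isCompact_iff_compactSpace.1 (isCompact_projLine _)
  exact ⟨(hcont.homeoOfEquivCompactToT2).symm, fun y => rfl⟩

end CFF
end
end
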